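/- arXiv:2106.13748 — 5 statements merged into one kernel-verified Lean document; each statement's English description precedes it below -/
import Mathlib

section
/- Let a ≥ 1 be an integer and let N be an integer with N > 4(9a + 8). Then for every four lattice points i, j, ℓ, m ∈ ℤ²₀,N there exists k' ∈ ℤ²₀,N with max(|k'₁|,|k'₂|) ≤ ⌊N/2⌋ − a such that all of i, j, ℓ, m belong to G^{k'}. -/
/-- The truncated lattice `ℤ²₀,N` as a subset of `ℤ²`. -/
def Z2set (N : ℤ) : Set (ℤ × ℤ) := {k | k ≠ 0 ∧ |k.1| ≤ N ∧ |k.2| ≤ N}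

/-- `S^k = ℤ²₀,N ∩ (ℤ²₀,N + k)`. -/
def Sset (N : ℤ) (k : ℤ × ℤ) : Set (ℤ × ℤ) := Z2set N ∩ {p | p - k ∈ Z2set N}

/-- `K^{k'} = {k ∈ ℤ²₀,N : |k − k'|_{ℓ∞} ≤ a}`. -/
def Kset (N a : ℤ) (k' : ℤ × ℤ) : Set (ℤ × ℤ) :=
  {k ∈ Z2set N | |k.1 - k'.1| ≤ a ∧ |k.2 - k'.2| ≤ a}

/-- `G^{k'}_+ = ⋂_{k ∈ K^{k'}} (S^k ∖ S^{−k})`. -/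
def Gplus (N a : ℤ) (k' : ℤ × ℤ) : Set (ℤ × ℤ) := ⋂ k ∈ Kset N a k', Sset N k \ Sset N (-k)

/-- `G^{k'}_− = ⋂_{k ∈ K^{k'}} (S^{−k} ∖ S^{k})`. -/
def Gminus (N a : ℤ) (k' : ℤ × ℤ) : Set (ℤ × ℤ) := ⋂ k ∈ Kset N a k', Sset N (-k) \ Sset N k

/-- `Ḡ^{k'} = ⋂_{k ∈ K^{k'}} (S^k ∩ S^{−k})`. -/
def Gbar (N a : ℤ) (k' : ℤ × ℤ) : Set (ℤ × ℤ) := ⋂ k ∈ Kset N a k', Sset N k ∩ Sset N (-k)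

/-- `G^{k'}_0 = ⋂_{k ∈ K^{k'}} (ℤ²₀,N ∖ (S^k ∪ S^{−k}))`. -/
def Gzero (N a : ℤ) (k' : ℤ × ℤ) : Set (ℤ × ℤ) :=
  ⋂ k ∈ Kset N a k', Z2set N \ (Sset N k ∪ Sset N (-k))

/-- The good set `G^{k'} = G^{k'}_+ ∪ G^{k'}_− ∪ Ḡ^{k'} ∪ G^{k'}_0`. -/
def Ggood (N a : ℤ) (k' : ℤ × ℤ) : Set (ℤ × ℤ) :=
  Gplus N a k' ∪ Gminus N a k' ∪ Gbar N a k' ∪ Gzero N a k'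

/-- Fewer than `(hi - lo + 1) / (2a + 1)` points leave an integer of `[lo, hi]` at distance more
than `a` from all of them. -/
theorem exists_forall_lt_abs_sub (a lo hi : ℤ) (ha : 0 ≤ a) (s : Finset ℤ)
    (hs : s.card * (2 * a + 1) < hi - lo + 1) :
    ∃ x, lo ≤ x ∧ x ≤ hi ∧ ∀ c ∈ s, a < |x - c| := by
  by_contra! h
  have hsub : Finset.Icc lo hi ⊆ s.biUnion fun c => Finset.Icc (c - a) (c + a) := by
    intro x hx
    rw [Finset.mem_Icc] at hx
    obtain ⟨c, hc, hxc⟩ := h x hx.1 hx.2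
    rw [abs_le] at hxc
    exact Finset.mem_biUnion.2 ⟨c, hc, Finset.mem_Icc.2 ⟨by linarith, by linarith⟩⟩
  have hcard := (Finset.card_le_card hsub).trans
    (Finset.card_biUnion_le_card_mul s _ (2 * a + 1).toNat fun c _ => by
      rw [Int.card_Icc]; omega)
  rw [Int.card_Icc] at hcard
  have hcast : ((hi + 1 - lo).toNat : ℤ) ≤ s.card * ((2 * a + 1).toNat : ℤ) := by
    exact_mod_cast hcard
  rw [Int.toNat_of_nonneg (show 0 ≤ 2 * a + 1 by omega)] at hcast
  omega

theorem mem_Z2set_sub_iff {N : ℤ} {p k : ℤ × ℤ} (hp : |p.1| ≠ |k.1|) :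
    p - k ∈ Z2set N ↔ |p.1 - k.1| ≤ N ∧ |p.2 - k.2| ≤ N := by
  refine ⟨fun h => h.2, fun h => ⟨fun h0 => hp ?_, h⟩⟩
  rw [sub_eq_zero.1 h0]

/-- If membership of `p` in `S^k` and in `S^{-k}` does not depend on `k ∈ K^{k'}`, then `p` is
good for `k'`. -/
theorem mem_Ggood_of_const {N a : ℤ} {k' p : ℤ × ℤ} (hp : p ∈ Z2set N)
    (h : ∀ k ∈ Kset N a k',
      (p ∈ Sset N k ↔ p ∈ Sset N k') ∧ (p ∈ Sset N (-k) ↔ p ∈ Sset N (-k'))) :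
    p ∈ Ggood N a k' := by
  simp only [Ggood, Gplus, Gminus, Gbar, Gzero, Set.mem_union, Set.mem_iInter₂, Set.mem_sdiff,
    Set.mem_inter_iff]
  by_cases h₁ : p ∈ Sset N k' <;> by_cases h₂ : p ∈ Sset N (-k')
  · exact .inl (.inr fun k hk => ⟨(h k hk).1.2 h₁, (h k hk).2.2 h₂⟩)
  · exact .inl (.inl (.inl fun k hk => ⟨(h k hk).1.2 h₁, mt (h k hk).2.1 h₂⟩))
  · exact .inl (.inl (.inr fun k hk => ⟨(h k hk).2.2 h₂, mt (h k hk).1.1 h₁⟩))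
  · exact .inr fun k hk =>
      ⟨hp, not_or.2 ⟨mt (h k hk).1.1 h₁, mt (h k hk).2.1 h₂⟩⟩

theorem abs_sub_le_iff_of_far {N a p x z : ℤ} (hp : |p| ≤ N) (hx : a ≤ x)
    (hxN : x + a ≤ N) (hfar : a < |x - (N - |p|)|) (hz : |z - x| ≤ a) :
    (|p - z| ≤ N ↔ |p - x| ≤ N) ∧ (|p + z| ≤ N ↔ |p + x| ≤ N) := by
  simp only [abs_le, lt_abs] at *
  rcases abs_cases p with h | h <;> omega

theorem mem_Ggood_of_far {N a : ℤ} {k' p : ℤ × ℤ} (ha : 0 ≤ a) (hp : p ∈ Z2set N)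
    (hx : a ≤ k'.1) (hxN : k'.1 + a ≤ N) (hy : a ≤ k'.2) (hyN : k'.2 + a ≤ N)
    (hx_far : a < |k'.1 - (N - |p.1|)|) (hy_far : a < |k'.2 - (N - |p.2|)|)
    (hne : a < |(k'.1 - |p.1|)|) : p ∈ Ggood N a k' := by
  refine mem_Ggood_of_const hp fun k hk => ?_
  have hne_of (z : ℤ) (hz : |z - k'.1| ≤ a) : |p.1| ≠ |z| := by
    rw [abs_of_nonneg (show 0 ≤ z by rw [abs_le] at hz; omega)]
    rintro h
    rw [h, abs_sub_comm] at hne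
    omega
  have hk₁ := hne_of k.1 hk.2.1
  have hk₂ := hne_of k'.1 (by simpa using ha)
  have e₁ := abs_sub_le_iff_of_far hp.2.1 hx hxN hx_far hk.2.1
  have e₂ := abs_sub_le_iff_of_far hp.2.2 hy hyN hy_far hk.2.2
  constructor
  · simp only [Sset, Set.mem_inter_iff, Set.mem_ofPred_eq]
    rw [mem_Z2set_sub_iff hk₁, mem_Z2set_sub_iff hk₂, e₁.1, e₂.1]
  · simp only [Sset, Set.mem_inter_iff, Set.mem_ofPred_eq]
    rw [mem_Z2set_sub_iff (by simpa using hk₁), mem_Z2set_sub_iff (by simpa using hk₂)]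
    simp only [Prod.fst_neg, Prod.snd_neg, sub_neg_eq_add]
    rw [e₁.2, e₂.2]

/-- For `a ≥ 1` and `N > 4(9a+8)`, any four lattice points of `ℤ²₀,N` lie in a
common good set `G^{k'}` for some `k' ∈ ℤ²₀,N` with `|k'|_{ℓ∞} ≤ ⌊N/2⌋ − a`. -/
theorem stmt15 (a N : ℤ) (ha : 1 ≤ a) (hN : 4 * (9 * a + 8) < N)
    (i j l m : ℤ × ℤ) (hi : i ∈ Z2set N) (hj : j ∈ Z2set N)
    (hl : l ∈ Z2set N) (hm : m ∈ Z2set N) :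
    ∃ k' ∈ Z2set N, max |k'.1| |k'.2| ≤ N / 2 - a ∧
      i ∈ Ggood N a k' ∧ j ∈ Ggood N a k' ∧ l ∈ Ggood N a k' ∧ m ∈ Ggood N a k' := by
  have avoid (s : Finset ℤ) (hs : s.card ≤ 8) :
      ∃ x, a ≤ x ∧ x ≤ N / 2 - a ∧ ∀ c ∈ s, a < |x - c| := by
    refine exists_forall_lt_abs_sub a _ _ (by omega) s ?_
    have : (s.card : ℤ) * (2 * a + 1) ≤ 8 * (2 * a + 1) :=
      mul_le_mul_of_nonneg_right (by exact_mod_cast hs) (by omega)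
    omega
  obtain ⟨x, hx, hxN, hx_far⟩ := avoid
    ({N - |i.1|, N - |j.1|, N - |l.1|, N - |m.1|} ∪ {|i.1|, |j.1|, |l.1|, |m.1|})
    ((Finset.card_union_le _ _).trans (add_le_add Finset.card_le_four Finset.card_le_four))
  obtain ⟨y, hy, hyN, hy_far⟩ := avoid {N - |i.2|, N - |j.2|, N - |l.2|, N - |m.2|}
    (Finset.card_le_four.trans (by norm_num))
  have good (p : ℤ × ℤ) (hp : p ∈ Z2set N) (h₁ : a < |x - (N - |p.1|)|)
      (h₂ : a < |y - (N - |p.2|)|) (h₃ : a < |(x - |p.1|)|) : p ∈ Ggood N a (x, y) :=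
    mem_Ggood_of_far (by omega) hp hx (by dsimp only; omega) hy (by dsimp only; omega) h₁ h₂ h₃
  have hx_abs : |x| = x := abs_of_nonneg (by omega)
  have hy_abs : |y| = y := abs_of_nonneg (by omega)
  refine ⟨(x, y), ⟨fun h => ?_, ?_, ?_⟩, ?_, good i hi ?_ ?_ ?_, good j hj ?_ ?_ ?_,
    good l hl ?_ ?_ ?_, good m hm ?_ ?_ ?_⟩
  · have : x = 0 := congrArg Prod.fst h
    omega
  · dsimp only; omega
  · dsimp only; omega
  · simp only [hx_abs, hy_abs]; omega
  all_goals first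
    | exact hx_far _ (by simp)
    | exact hy_far _ (by simp)
end

section
/- Let a ≥ 1 be an integer and let N be an integer with N > 4(9a + 8). Then for every four lattice points i, j, ℓ, m ∈ ℤ²₀,N there exists k' ∈ ℤ²₀,N with max(|k'₁|,|k'₂|) ≤ N − a such that all of i, j, ℓ, m belong to G^{k'} and not all four of i, j, ℓ, m belong to G^{k'}_0. -/
/-- Some point of `[a + 1, N - a]` is at distance more than `a` from each of at most eight given
centers. -/
lemma exists_far_from_finset (a N : ℤ) (ha : 0 ≤ a) (hN : 18 * a + 9 ≤ N) (s : Finset ℤ)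
    (hs : s.card ≤ 8) : ∃ x, a < x ∧ x ≤ N - a ∧ ∀ c ∈ s, a < |x - c| := by
  by_contra! hcon
  have near : ∀ t : ℕ, t ∈ Finset.range 9 → ∃ c ∈ s, |a + 1 + (2 * a + 1) * t - c| ≤ a := by
    intro t ht
    have ht8 : (t : ℤ) ≤ 8 := by have := Finset.mem_range.1 ht; omega
    exact hcon _ (by nlinarith [Int.natCast_nonneg t]) (by nlinarith)
  choose! f hfs hf using near
  obtain ⟨t, ht, u, hu, htu, hfe⟩ := Finset.exists_ne_map_eq_of_card_lt_of_maps_to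
    (s := Finset.range 9) (t := s) (f := f) (by simpa using by omega) hfs
  have h₁ := abs_le.1 (hf t ht)
  have h₂ := abs_le.1 (hf u hu)
  rw [hfe] at h₁
  rcases lt_or_gt_of_ne htu with h | h
  · have : (t : ℤ) + 1 ≤ u := by exact_mod_cast h
    nlinarith
  · have : (u : ℤ) + 1 ≤ t := by exact_mod_cast h
    nlinarith

/-- Far from the threshold `N - |u|`, membership of `u - k` and `u + k` in `[-N, N]` does not
depend on `k` in the `a`-neighbourhood of `κ`. -/
lemma shift_mem_box_trichotomy (a N u κ : ℤ) (hu : |u| ≤ N) (hκ : a < |κ|)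
    (hfar : a < |(|κ|) - (N - |u|)|) :
    (∀ k, |k| ≤ N → |k - κ| ≤ a → |u - k| ≤ N ∧ |u + k| ≤ N) ∨
    (∀ k, |k| ≤ N → |k - κ| ≤ a → |u - k| ≤ N ∧ ¬ |u + k| ≤ N) ∨
    (∀ k, |k| ≤ N → |k - κ| ≤ a → ¬ |u - k| ≤ N ∧ |u + k| ≤ N) := by
  by_cases hA : |κ| < N - |u|
  · left
    intro k hk hd
    grind
  · by_cases hs : 0 ≤ u ↔ 0 ≤ κ
    · right; left
      intro k hk hd
      grind
    · right; right
      intro k hk hd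
      grind

lemma mem_Sset_iff {N : ℤ} {p k : ℤ × ℤ} (hp : p ∈ Z2set N) (hne : p.1 ≠ k.1) :
    p ∈ Sset N k ↔ |p.1 - k.1| ≤ N ∧ |p.2 - k.2| ≤ N := by
  have : p - k ≠ 0 := fun h => hne (sub_eq_zero.1 (congrArg Prod.fst h))
  simp [Sset, Z2set, this] at hp ⊢
  tauto

lemma mem_Sset_neg_iff {N : ℤ} {p k : ℤ × ℤ} (hp : p ∈ Z2set N) (hne : p.1 ≠ -k.1) :
    p ∈ Sset N (-k) ↔ |p.1 + k.1| ≤ N ∧ |p.2 + k.2| ≤ N := by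
  simpa using mem_Sset_iff (k := -k) hp hne

lemma mem_Ggood_of_far_s16 {a N : ℤ} {p k' : ℤ × ℤ} (hp : p ∈ Z2set N)
    (h₁ : a < |k'.1|) (h₂ : a < |k'.2|) (hp₁ : a < |(|k'.1|) - (|p.1|)|)
    (hN₁ : a < |(|k'.1|) - (N - |p.1|)|) (hN₂ : a < |(|k'.2|) - (N - |p.2|)|) :
    p ∈ Ggood N a k' := by
  have hS : ∀ k ∈ Kset N a k',
      (p ∈ Sset N k ↔ |p.1 - k.1| ≤ N ∧ |p.2 - k.2| ≤ N) ∧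
      (p ∈ Sset N (-k) ↔ |p.1 + k.1| ≤ N ∧ |p.2 + k.2| ≤ N) := by
    rintro k ⟨-, hk, -⟩
    exact ⟨mem_Sset_iff hp (by grind), mem_Sset_neg_iff hp (by grind)⟩
  have key : (∀ k ∈ Kset N a k', p ∈ Sset N k ∧ p ∉ Sset N (-k)) ∨
      (∀ k ∈ Kset N a k', p ∈ Sset N (-k) ∧ p ∉ Sset N k) ∨
      (∀ k ∈ Kset N a k', p ∈ Sset N k ∧ p ∈ Sset N (-k)) ∨
      (∀ k ∈ Kset N a k', p ∉ Sset N k ∧ p ∉ Sset N (-k)) := by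
    have hK : ∀ k ∈ Kset N a k',
        (|k.1| ≤ N ∧ |k.1 - k'.1| ≤ a) ∧ (|k.2| ≤ N ∧ |k.2 - k'.2| ≤ a) :=
      fun k hk => ⟨⟨hk.1.2.1, hk.2.1⟩, ⟨hk.1.2.2, hk.2.2⟩⟩
    rcases shift_mem_box_trichotomy a N p.1 k'.1 hp.2.1 h₁ hN₁ with hx | hx | hx <;>
    rcases shift_mem_box_trichotomy a N p.2 k'.2 hp.2.2 h₂ hN₂ with hy | hy | hy
    · exact .inr (.inr (.inl fun k hk => by grind))
    · exact .inl fun k hk => by grind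
    · exact .inr (.inl fun k hk => by grind)
    · exact .inl fun k hk => by grind
    · exact .inl fun k hk => by grind
    · exact .inr (.inr (.inr fun k hk => by grind))
    · exact .inr (.inl fun k hk => by grind)
    · exact .inr (.inr (.inr fun k hk => by grind))
    · exact .inr (.inl fun k hk => by grind)
  simp only [Ggood, Gplus, Gminus, Gbar, Gzero, Set.mem_union, Set.mem_iInter, Set.mem_sdiff,
    Set.mem_inter_iff, not_or, hp, true_and]
  tauto

/-- Reflecting the second coordinate of `k'` takes a point out of `G^{k'}_0`. -/
lemma notMem_Gzero_reflect {a N x y : ℤ} {p : ℤ × ℤ} (ha : 0 ≤ a) (hp : p ∈ Z2set N)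
    (hx : 0 < x) (hxN : x ≤ N) (hy : 0 < y) (hyN : y ≤ N) (hxp : x ≠ |p.1|)
    (h : p ∈ Gzero N a (x, y)) : p ∉ Gzero N a (x, -y) := by
  intro h'
  have mem : ∀ z : ℤ, |z| ≤ N → ((x, z) : ℤ × ℤ) ∈ Kset N a (x, z) := fun z hz =>
    ⟨⟨fun e => hx.ne' (congrArg Prod.fst e), (abs_of_pos hx).trans_le hxN, hz⟩,
      by simpa using ha, by simpa using ha⟩
  have e := (Set.mem_iInter₂.1 h _ (mem y (by grind))).2
  have e' := (Set.mem_iInter₂.1 h' _ (mem (-y) (by grind))).2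
  rw [Set.mem_union, mem_Sset_iff hp (by grind), mem_Sset_neg_iff hp (by grind)] at e e'
  have h₁ := hp.2.1
  have h₂ := hp.2.2
  grind

/-- For `a ≥ 1` and `N > 4(9a+8)`, any four lattice points of `ℤ²₀,N` lie in a
common good set `G^{k'}` for some `k' ∈ ℤ²₀,N` with `|k'|_{ℓ∞} ≤ N − a`, and moreover not all
four of them lie in `G^{k'}_0`. -/
theorem stmt16 (a N : ℤ) (ha : 1 ≤ a) (hN : 4 * (9 * a + 8) < N)
    (i j l m : ℤ × ℤ) (hi : i ∈ Z2set N) (hj : j ∈ Z2set N)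
    (hl : l ∈ Z2set N) (hm : m ∈ Z2set N) :
    ∃ k' ∈ Z2set N, max |k'.1| |k'.2| ≤ N - a ∧
      (i ∈ Ggood N a k' ∧ j ∈ Ggood N a k' ∧ l ∈ Ggood N a k' ∧ m ∈ Ggood N a k') ∧
      ¬(i ∈ Gzero N a k' ∧ j ∈ Gzero N a k' ∧ l ∈ Gzero N a k' ∧ m ∈ Gzero N a k') := by
  classical
  obtain ⟨x, hx, hxN, hxs⟩ := exists_far_from_finset a N (by omega) (by omega)
    ({|i.1|, |j.1|, |l.1|, |m.1|, N - |i.1|, N - |j.1|, N - |l.1|, N - |m.1|} : Finset ℤ)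
    ((Finset.card_insert_le _ _).trans (Nat.succ_le_succ
      ((Finset.card_insert_le _ _).trans (Nat.succ_le_succ Finset.card_le_six))))
  obtain ⟨y, hy, hyN, hys⟩ := exists_far_from_finset a N (by omega) (by omega)
    ({N - |i.2|, N - |j.2|, N - |l.2|, N - |m.2|} : Finset ℤ)
    (Finset.card_le_four.trans (by norm_num))
  simp only [Finset.mem_insert, Finset.mem_singleton, forall_eq_or_imp, forall_eq] at hxs hys
  obtain ⟨xi, xj, xl, xm, xi', xj', xl', xm'⟩ := hxs
  obtain ⟨yi, yj, yl, ym⟩ := hys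
  have habs : |x| = x := abs_of_pos (by omega)
  have good : ∀ z : ℤ, |z| = y → (x, z) ∈ Z2set N ∧ max |x| |z| ≤ N - a ∧
      (i ∈ Ggood N a (x, z) ∧ j ∈ Ggood N a (x, z) ∧
        l ∈ Ggood N a (x, z) ∧ m ∈ Ggood N a (x, z)) := by
    intro z hz
    have far : ∀ p ∈ Z2set N, a < |x - (|p.1|)| → a < |x - (N - |p.1|)| →
        a < |y - (N - |p.2|)| → p ∈ Ggood N a (x, z) := fun p hp h₁ h₂ h₃ =>
      mem_Ggood_of_far_s16 hp (by simpa [habs]) (by simpa [hz]) (by simpa [habs])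
        (by simpa [habs]) (by simpa [hz])
    refine ⟨⟨fun e => ?_, ?_, ?_⟩, ?_, far i hi xi xi' yi, far j hj xj xj' yj,
      far l hl xl xl' yl, far m hm xm xm' ym⟩
    · have : x = 0 := congrArg Prod.fst e
      omega
    · change |x| ≤ N
      omega
    · change |z| ≤ N
      omega
    · exact max_le (by omega) (by omega)
  by_cases hz : i ∈ Gzero N a (x, y)
  · obtain ⟨h₁, h₂, h₃⟩ := good (-y) (by rw [abs_neg, abs_of_pos (by omega)])
    exact ⟨(x, -y), h₁, h₂, h₃, fun h => notMem_Gzero_reflect (by omega) hi (by omega) (by omega)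
      (by omega) (by omega) (by grind) hz h.1⟩
  · obtain ⟨h₁, h₂, h₃⟩ := good y (abs_of_pos (by omega))
    exact ⟨(x, y), h₁, h₂, h₃, fun h => hz h.1⟩
end

section
/- Let P be a polynomial over ℂ in n + m variables (x₁,…,x_n, y₁,…,y_m) whose total degree in the variables y = (y₁,…,y_m) is at most J. Suppose K ⊆ ℤ^m contains a full box {y ∈ ℤ^m : max_i |y_i − y'_i| ≤ q} for some y' ∈ ℤ^m and some integer q with 2q + 1 > J. Let {f₁,…,f_s} ⊆ ℂ[x₁,…,x_n] be the coefficients of P viewed as a polynomial in y with coefficients in ℂ[x₁,…,x_n], and for y ∈ ℤ^m let P_y ∈ ℂ[x₁,…,x_n] denote the polynomial obtained by substituting the integer point y for (y₁,…,y_m) in P. Then the ideals of ℂ[x₁,…,x_n] generated by {f₁,…,f_s} and by {P_y : y ∈ K} are equal. -/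
/-- If a polynomial with coefficients in a `k`-algebra `A` takes values in a `k`-subspace `N` of `A`
on a sufficiently large grid of points of `k`, then all its coefficients lie in `N`. -/
theorem MvPolynomial.coeff_mem_of_eval_algebraMap_mem {k A σ : Type*} [Field k] [CommRing A]
    [Algebra k A] [Finite σ] (N : Submodule k A) (Q : MvPolynomial σ A) (S : σ → Finset k)
    (hdeg : ∀ i, Q.degreeOf i < (S i).card)
    (heval : ∀ x : σ → k, (∀ i, x i ∈ S i) → eval (fun i => algebraMap k A (x i)) Q ∈ N)
    (d : σ →₀ ℕ) : coeff d Q ∈ N := by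
  classical
  by_contra hd
  obtain ⟨φ, hφ, hN⟩ := Submodule.exists_le_ker_of_notMem hd
  let R : MvPolynomial σ k := ∑ e ∈ Q.support, monomial e (φ (coeff e Q))
  have hcoeff (e : σ →₀ ℕ) : coeff e R = φ (coeff e Q) := by
    simp only [R, coeff_sum, coeff_monomial, Finset.sum_ite_eq', mem_support_iff]
    split_ifs with h
    · rfl
    · rw [not_not.mp h, map_zero]
  have hsupp : R.support ⊆ Q.support := by
    intro e he
    rw [mem_support_iff] at he ⊢
    intro h
    exact he (by rw [hcoeff, h, map_zero])
  have hR : R = 0 := by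
    refine eq_zero_of_eval_zero_at_prod_finset R S (fun i => ?_) (fun x hx => ?_)
    · refine lt_of_le_of_lt ?_ (hdeg i)
      rw [degreeOf_eq_sup, degreeOf_eq_sup]
      exact Finset.sup_mono hsupp
    · have h0 : φ (eval (fun i => algebraMap k A (x i)) Q) = 0 := hN (heval x hx)
      rw [eval_eq, map_sum] at h0
      simp only [R, map_sum, eval_monomial]
      refine Eq.trans (Finset.sum_congr rfl fun e _ => ?_) h0
      have h1 : coeff e Q * ∏ i ∈ e.support, algebraMap k A (x i) ^ e i =
          (∏ i ∈ e.support, x i ^ e i) • coeff e Q := by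
        rw [Algebra.smul_def, map_prod, mul_comm]
        simp only [map_pow]
      rw [h1, map_smul, smul_eq_mul, mul_comm, Finsupp.prod]
  exact hφ (by rw [← hcoeff, hR, coeff_zero])

/-- Let `Q` be a polynomial in `m` variables `y` with coefficients in the
polynomial ring `ℂ[x₁,…,x_n]`, of total degree at most `J` in `y`. If `K ⊆ ℤ^m` contains a full
box of radius `q` around some `y'` with `2q + 1 > J`, then the ideal of `ℂ[x₁,…,x_n]` generated
by the coefficients of `Q` equals the ideal generated by the evaluations `P_y`, `y ∈ K`. -/
theorem stmt17 (n m J : ℕ)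
    (Q : MvPolynomial (Fin m) (MvPolynomial (Fin n) ℂ))
    (hdeg : Q.totalDegree ≤ J)
    (K : Set (Fin m → ℤ)) (q : ℤ) (hq : (J : ℤ) < 2 * q + 1)
    (y' : Fin m → ℤ)
    (hbox : ∀ y : Fin m → ℤ, (∀ i, |y i - y' i| ≤ q) → y ∈ K) :
    Ideal.span {f : MvPolynomial (Fin n) ℂ | ∃ d ∈ Q.support, f = MvPolynomial.coeff d Q} =
      Ideal.span {g : MvPolynomial (Fin n) ℂ |
        ∃ y ∈ K, g = MvPolynomial.eval (fun i => ((y i : ℤ) : MvPolynomial (Fin n) ℂ)) Q} := by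
  apply le_antisymm
  · rw [Ideal.span_le]
    rintro _ ⟨d, -, rfl⟩
    refine MvPolynomial.coeff_mem_of_eval_algebraMap_mem (k := ℂ)
      (Submodule.restrictScalars ℂ (Ideal.span _)) Q
      (fun i => (Finset.Icc (y' i - q) (y' i + q)).image (fun z : ℤ => (z : ℂ))) ?_ ?_ d
    · intro i
      rw [Finset.card_image_of_injective _ Int.cast_injective, Int.card_Icc]
      have := (MvPolynomial.degreeOf_le_totalDegree Q i).trans hdeg
      omega
    · intro x hx
      simp only [Finset.mem_image, Finset.mem_Icc] at hx
      choose y hy hyx using hx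
      refine Ideal.subset_span ⟨y, hbox y fun i => ?_, ?_⟩
      · have := hy i
        rw [abs_le]
        constructor <;> linarith
      · simp only [← hyx, map_intCast]
  · rw [Ideal.span_le]
    rintro _ ⟨y, -, rfl⟩
    rw [MvPolynomial.eval_eq]
    exact Ideal.sum_mem _ fun d hd =>
      Ideal.mul_mem_right _ _ (Ideal.subset_span ⟨d, hd, rfl⟩)
end

section
/- Let r > 0 be real and let i, j, ℓ, m ∈ ℤ²₀ satisfy i + j + ℓ + m = 0, (i+j, ℓ+m) ≠ (0,0), (i+ℓ, j+m) ≠ (0,0), and (i+m, j+ℓ) ≠ (0,0). Then there exists k ∈ ℤ²₀ with k ∉ {±i, ±j, ±ℓ, ±m} such that D̄(i,k,r) + D̄(j,k,r) + D̄(ℓ,k,r) + D̄(m,k,r) ≠ 0. -/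
/-- `|k|²_r = k₁² + r²k₂²`. -/
noncomputable def nsq (r : ℝ) (k : ℤ × ℤ) : ℝ := (k.1 : ℝ) ^ 2 + r ^ 2 * (k.2 : ℝ) ^ 2

/-- `⟨p⊥,k⟩_r = r(p₂k₁ − p₁k₂)`. -/
noncomputable def perp (r : ℝ) (p k : ℤ × ℤ) : ℝ :=
  r * ((p.2 : ℝ) * (k.1 : ℝ) - (p.1 : ℝ) * (k.2 : ℝ))

/-- `D̄(p,k,r) = ⟨p⊥,k⟩²_r (1/|k|²_r − 1/|p|²_r)(1/|p−k|²_r − 1/|p+k|²_r)`. -/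
noncomputable def Dbar (r : ℝ) (p k : ℤ × ℤ) : ℝ :=
  perp r p k ^ 2 * (1 / nsq r k - 1 / nsq r p) * (1 / nsq r (p - k) - 1 / nsq r (p + k))

/-- Numerator of `Dbar`, up to the factor `4 / (|p|²|k|²)`, over any commutative ring. -/
def dbarNum {A : Type*} [CommRing A] (ρ a b x y : A) : A :=
  (ρ * (b * x - a * y)) ^ 2 * ((a ^ 2 + ρ ^ 2 * b ^ 2) - (x ^ 2 + ρ ^ 2 * y ^ 2)) *
    (a * x + ρ ^ 2 * b * y)

/-- The factor `|p - k|²|p + k|²` of the denominator of `Dbar`, over any commutative ring. -/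
def dbarDen {A : Type*} [CommRing A] (ρ a b x y : A) : A :=
  ((a - x) ^ 2 + ρ ^ 2 * (b - y) ^ 2) * ((a + x) ^ 2 + ρ ^ 2 * (b + y) ^ 2)

/-- Numerator of a linear combination of the functions `Dbar r q`, `q ∈ S`. -/
def dbarSumNum {A : Type*} [CommRing A] (φ : ℝ →+* A) (r : ℝ) (S : Finset (ℤ × ℤ))
    (d : ℤ × ℤ → ℝ) (x y : A) : A :=
  ∑ q ∈ S, φ (d q) * dbarNum (φ r) q.1 q.2 x y *
    ∏ q' ∈ S.erase q, dbarDen (φ r) q'.1 q'.2 x y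

lemma map_dbarSumNum {A B : Type*} [CommRing A] [CommRing B] (f : A →+* B) (φ : ℝ →+* A)
    (r : ℝ) (S : Finset (ℤ × ℤ)) (d : ℤ × ℤ → ℝ) (x y : A) :
    f (dbarSumNum φ r S d x y) = dbarSumNum (f.comp φ) r S d (f x) (f y) := by
  simp [dbarSumNum, dbarNum, dbarDen]

lemma nsq_pos {r : ℝ} (hr : r ≠ 0) {k : ℤ × ℤ} (hk : k ≠ 0) : 0 < nsq r k := by
  have hr2 : 0 < r ^ 2 := by positivity
  unfold nsq
  by_cases h1 : k.1 = 0
  · have h2 : k.2 ≠ 0 := fun h2 => hk (Prod.ext h1 h2)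
    have : (k.2 : ℝ) ≠ 0 := by exact_mod_cast h2
    positivity
  · have : (k.1 : ℝ) ≠ 0 := by exact_mod_cast h1
    positivity

lemma dbarDen_eq (r : ℝ) (p k : ℤ × ℤ) :
    dbarDen r p.1 p.2 k.1 k.2 = nsq r (p - k) * nsq r (p + k) := by
  simp [dbarDen, nsq]

lemma dbarNum_eq {r : ℝ} (hr : r ≠ 0) {p k : ℤ × ℤ} (hp : p ≠ 0) (hk : k ≠ 0)
    (hs : p - k ≠ 0) (ha : p + k ≠ 0) :
    dbarNum r p.1 p.2 k.1 k.2 / nsq r p =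
      Dbar r p k * nsq r k / 4 * dbarDen r p.1 p.2 k.1 k.2 := by
  have e : nsq r (p + k) - nsq r (p - k) = 4 * (p.1 * k.1 + r ^ 2 * p.2 * k.2) := by
    simp [nsq]; ring
  have h1 := (nsq_pos hr hp).ne'
  have h2 := (nsq_pos hr hk).ne'
  have h3 := (nsq_pos hr hs).ne'
  have h4 := (nsq_pos hr ha).ne'
  have e2 : dbarNum r p.1 p.2 k.1 k.2 =
      perp r p k ^ 2 * (nsq r p - nsq r k) * ((nsq r (p + k) - nsq r (p - k)) / 4) := by
    rw [e]; simp only [dbarNum, perp, nsq]; ring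
  rw [dbarDen_eq, e2, Dbar]
  field_simp

/-- If a linear combination of the functions `Dbar r q` vanishes away from its poles, then
its numerator vanishes identically over `ℂ`. -/
lemma dbarSumNum_eq_zero {r : ℝ} (hr : r ≠ 0) (S : Finset (ℤ × ℤ)) (hS : ∀ q ∈ S, q ≠ 0)
    (c : ℤ × ℤ → ℝ)
    (h : ∀ k : ℤ × ℤ, k ≠ 0 → (∀ q ∈ S, k ≠ q ∧ k ≠ -q) → ∑ q ∈ S, c q * Dbar r q k = 0)
    (x y : ℂ) : dbarSumNum Complex.ofRealHom r S (fun q => c q / nsq r q) x y = 0 := by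
  set B : ℤ := ∑ q ∈ S, |q.1| with hB
  have hBq : ∀ q ∈ S, |q.1| ≤ B := fun q hq =>
    Finset.single_le_sum (f := fun q : ℤ × ℤ => |q.1|) (fun _ _ => abs_nonneg _) hq
  have hB0 : 0 ≤ B := Finset.sum_nonneg fun _ _ => abs_nonneg _
  have hint : ∀ k : ℤ × ℤ, B < k.1 →
      dbarSumNum (RingHom.id ℝ) r S (fun q => c q / nsq r q) k.1 k.2 = 0 := by
    intro k hk
    have hk0 : k ≠ 0 := by rintro rfl; simp at hk; omega
    have hne : ∀ q ∈ S, k ≠ q ∧ k ≠ -q := by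
      intro q hq
      have := abs_le.mp (hBq q hq)
      constructor <;> rintro rfl
      · omega
      · simp at hk; omega
    have hterm : ∀ q ∈ S, c q / nsq r q * dbarNum r q.1 q.2 k.1 k.2 *
        ∏ q' ∈ S.erase q, dbarDen r q'.1 q'.2 k.1 k.2 =
        c q * Dbar r q k * (nsq r k / 4 * ∏ q' ∈ S, dbarDen r q'.1 q'.2 k.1 k.2) := by
      intro q hq
      have hs : q - k ≠ 0 := fun e => (hne q hq).1 (sub_eq_zero.mp e).symm
      have ha : q + k ≠ 0 := fun e => (hne q hq).2 (eq_neg_of_add_eq_zero_right e)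
      rw [← Finset.mul_prod_erase S _ hq]
      linear_combination c q * (∏ q' ∈ S.erase q, dbarDen (r : ℝ) q'.1 q'.2 k.1 k.2) *
        dbarNum_eq hr (hS q hq) hk0 hs ha
    simp only [dbarSumNum, RingHom.id_apply]
    rw [Finset.sum_congr rfl hterm, ← Finset.sum_mul, h k hk0 hne, zero_mul]
  have hP : dbarSumNum (MvPolynomial.C.comp Complex.ofRealHom) r S (fun q => c q / nsq r q)
      (MvPolynomial.X 0) (MvPolynomial.X 1 : MvPolynomial (Fin 2) ℂ) = 0 := by
    refine MvPolynomial.funext_set (fun _ => (fun n : ℤ => (n : ℂ)) '' Set.Ioi B)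
      (fun _ => (Set.Ioi_infinite B).image Int.cast_injective.injOn) fun z hz => ?_
    obtain ⟨a, ha, hza⟩ := hz 0 trivial
    obtain ⟨b, hb, hzb⟩ := hz 1 trivial
    have := congrArg Complex.ofRealHom (hint (a, b) ha)
    rw [map_dbarSumNum] at this
    rw [map_dbarSumNum, ← RingHom.comp_assoc]
    have hid : (MvPolynomial.eval z).comp MvPolynomial.C = RingHom.id ℂ := by
      ext w; simp
    rw [hid]
    simpa [← hza, ← hzb] using this
  have := congrArg (MvPolynomial.eval ![x, y]) hP
  have hid : (MvPolynomial.eval ![x, y]).comp MvPolynomial.C = RingHom.id ℂ := by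
    ext w; simp
  rw [map_dbarSumNum, ← RingHom.comp_assoc, hid] at this
  simpa using this

/-- The linear form `k ↦ k₁ + i r k₂`. -/
noncomputable def isotropic (r : ℝ) (p : ℤ × ℤ) : ℂ := ⟨p.1, r * p.2⟩

lemma isotropic_injective {r : ℝ} (hr : r ≠ 0) : Function.Injective (isotropic r) := by
  intro p q h
  simp only [isotropic, Complex.mk.injEq, mul_eq_mul_left_iff, hr, or_false, Int.cast_inj] at h
  exact Prod.ext h.1 h.2

lemma isotropic_neg (r : ℝ) (p : ℤ × ℤ) : isotropic r (-p) = -isotropic r p := by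
  apply Complex.ext <;> simp [isotropic]

lemma isotropic_eq (r : ℝ) (p : ℤ × ℤ) : isotropic r p = p.1 + Complex.I * r * p.2 := by
  apply Complex.ext <;> simp [isotropic]

lemma conj_isotropic_eq (r : ℝ) (p : ℤ × ℤ) :
    star (isotropic r p) = p.1 - Complex.I * r * p.2 := by
  apply Complex.ext <;> simp [isotropic]

lemma dbarDen_isotropic (r : ℝ) (q : ℤ × ℤ) (x y : ℂ) :
    dbarDen (r : ℂ) q.1 q.2 x y =
      (isotropic r q - (x + Complex.I * r * y)) * (star (isotropic r q) - (x - Complex.I * r * y)) *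
      ((isotropic r q + (x + Complex.I * r * y)) *
        (star (isotropic r q) + (x - Complex.I * r * y))) := by
  rw [conj_isotropic_eq, isotropic_eq, dbarDen]
  linear_combination ((q.1 - x) ^ 2 * (r ^ 2 * (q.2 + y) ^ 2)
    + r ^ 2 * (q.2 - y) ^ 2 * (q.1 + x) ^ 2
    + (1 - Complex.I ^ 2) * r ^ 4 * (q.2 - y) ^ 2 * (q.2 + y) ^ 2) * Complex.I_sq

lemma dbarNum_isotropic (r : ℝ) (q : ℤ × ℤ) (x y : ℂ) :
    8 * dbarNum (r : ℂ) q.1 q.2 x y =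
      -(isotropic r q * (x - Complex.I * r * y) - star (isotropic r q) * (x + Complex.I * r * y)) ^ 2
      * (isotropic r q * star (isotropic r q)
          - (x + Complex.I * r * y) * (x - Complex.I * r * y))
      * (isotropic r q * (x - Complex.I * r * y)
          + star (isotropic r q) * (x + Complex.I * r * y)) := by
  have e1 : (isotropic r q * (x - Complex.I * r * y)
      - star (isotropic r q) * (x + Complex.I * r * y)) ^ 2
      = -4 * (r * (q.2 * x - q.1 * y)) ^ 2 := by
    rw [conj_isotropic_eq, isotropic_eq]
    linear_combination 4 * (r * (q.2 * x - q.1 * y) : ℂ) ^ 2 * Complex.I_sq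
  have e2 : isotropic r q * star (isotropic r q)
      - (x + Complex.I * r * y) * (x - Complex.I * r * y)
      = (q.1 ^ 2 + r ^ 2 * q.2 ^ 2) - (x ^ 2 + r ^ 2 * y ^ 2) := by
    rw [conj_isotropic_eq, isotropic_eq]
    linear_combination (-(r ^ 2 * q.2 ^ 2) + r ^ 2 * y ^ 2 : ℂ) * Complex.I_sq
  have e3 : isotropic r q * (x - Complex.I * r * y)
      + star (isotropic r q) * (x + Complex.I * r * y)
      = 2 * (q.1 * x + r ^ 2 * q.2 * y) := by
    rw [conj_isotropic_eq, isotropic_eq]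
    linear_combination (-2 * (r ^ 2 * q.2 * y) : ℂ) * Complex.I_sq
  rw [e1, e2, e3, dbarNum]
  ring

/-- Linear independence of the functions `Dbar r q` for `q` ranging over a finite set of
lattice points containing no two opposite ones. -/
theorem exists_sum_Dbar_ne_zero {r : ℝ} (hr : r ≠ 0) (S : Finset (ℤ × ℤ)) (hne : S.Nonempty)
    (hS : ∀ p ∈ S, ∀ q ∈ S, p ≠ -q) (c : ℤ × ℤ → ℝ) (hc : ∀ q ∈ S, c q ≠ 0) :
    ∃ k : ℤ × ℤ, k ≠ 0 ∧ (∀ q ∈ S, k ≠ q ∧ k ≠ -q) ∧ ∑ q ∈ S, c q * Dbar r q k ≠ 0 := by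
  by_contra! hcon
  have hS0 : ∀ q ∈ S, q ≠ 0 := by
    rintro q hq rfl
    exact hS _ hq _ hq (by simp)
  obtain ⟨p, hp⟩ := hne
  obtain ⟨v, hv⟩ := Infinite.exists_notMem_finset
    (S.image (fun q => star (isotropic r q)) ∪ S.image (fun q => -star (isotropic r q)))
  simp only [Finset.mem_union, Finset.mem_image, not_or, not_exists, not_and] at hv
  have hrC : (r : ℂ) ≠ 0 := by exact_mod_cast hr
  set u := isotropic r p with hu
  have hw0 : u ≠ 0 := by
    intro e
    refine hS0 p hp (isotropic_injective hr ?_)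
    rw [← hu, e]
    apply Complex.ext <;> simp [isotropic]
  obtain ⟨x, y, hxu, hxv⟩ : ∃ x y : ℂ, x + Complex.I * r * y = u ∧ x - Complex.I * r * y = v := by
    refine ⟨(u + v) / 2, (u - v) / (2 * Complex.I * r), ?_, ?_⟩ <;>
    · field_simp [Complex.I_ne_zero]
      ring
  have hzero := dbarSumNum_eq_zero hr S hS0 c hcon x y
  have hdp : dbarDen (r : ℂ) p.1 p.2 x y = 0 := by
    rw [dbarDen_isotropic, hxu, ← hu]; ring
  rw [dbarSumNum, Finset.sum_eq_single_of_mem p hp] at hzero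
  · simp only [Complex.ofRealHom_eq_coe, mul_eq_zero, Complex.ofReal_eq_zero, div_eq_zero_iff,
      hc p hp, (nsq_pos hr (hS0 p hp)).ne', or_self, false_or, Finset.prod_eq_zero_iff] at hzero
    have hvp : v ≠ star u := fun e => hv.1 p hp e.symm
    have hvp' : star u + v ≠ 0 := fun e => hv.2 p hp (eq_neg_of_add_eq_zero_right e).symm
    rcases hzero with hz | ⟨q, hq, hz⟩
    · have h8 := dbarNum_isotropic r p x y
      rw [hz, hxu, hxv, ← hu] at h8
      have : u ^ 4 * (v - star u) ^ 3 * (star u + v) = 0 := by linear_combination -h8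
      exact mul_ne_zero (mul_ne_zero (pow_ne_zero 4 hw0) (pow_ne_zero 3 (sub_ne_zero.mpr hvp)))
        hvp' this
    · obtain ⟨hqp, hq⟩ := Finset.mem_erase.mp hq
      rw [dbarDen_isotropic, hxu, hxv] at hz
      rcases mul_eq_zero.mp hz with hz | hz <;> rcases mul_eq_zero.mp hz with hz | hz
      · exact hqp (isotropic_injective hr (sub_eq_zero.mp hz))
      · exact hv.1 q hq (sub_eq_zero.mp hz)
      · refine hS q hq p hp (isotropic_injective hr ?_)
        rw [isotropic_neg]
        exact eq_neg_of_add_eq_zero_left hz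
      · exact hv.2 q hq (eq_neg_of_add_eq_zero_right hz).symm
  · intro q _ hqp
    rw [Finset.prod_eq_zero (Finset.mem_erase.mpr ⟨hqp.symm, hp⟩) (by simpa using hdp), mul_zero]

/-- (Infinite-dimensional distinctness.) For admissible `(i,j,l,m)` summing to
zero there is `k ∈ ℤ²₀`, `k ∉ {±i, ±j, ±l, ±m}`, with
`D̄(i,k,r) + D̄(j,k,r) + D̄(l,k,r) + D̄(m,k,r) ≠ 0`. -/
theorem stmt18 (r : ℝ) (hr : 0 < r) (i j l m : ℤ × ℤ)
    (hi : i ≠ 0) (hj : j ≠ 0) (hl : l ≠ 0) (hm : m ≠ 0)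
    (hsum : i + j + l + m = 0)
    (h1 : (i + j, l + m) ≠ (0, 0))
    (h2 : (i + l, j + m) ≠ (0, 0))
    (h3 : (i + m, j + l) ≠ (0, 0)) :
    ∃ k : ℤ × ℤ, k ≠ 0 ∧ k ≠ i ∧ k ≠ -i ∧ k ≠ j ∧ k ≠ -j ∧ k ≠ l ∧ k ≠ -l ∧ k ≠ m ∧ k ≠ -m ∧
      Dbar r i k + Dbar r j k + Dbar r l k + Dbar r m k ≠ 0 := by
  have key : ∀ a b c d : ℤ × ℤ, a + b + c + d = 0 → (a + b, c + d) ≠ (0, 0) →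
      a ≠ -b ∧ b ≠ -a ∧ c ≠ -d ∧ d ≠ -c := by
    intro a b c d hs hab
    have hab' : a + b ≠ 0 := by
      intro e
      refine hab (Prod.ext e ?_)
      simpa [add_assoc, e, ← add_assoc a b] using hs
    have hcd' : c + d ≠ 0 := by
      intro e
      rw [add_assoc, e, add_zero] at hs
      exact hab' hs
    exact ⟨fun e => hab' (by simp [e]), fun e => hab' (by simp [e]),
      fun e => hcd' (by simp [e]), fun e => hcd' (by simp [e])⟩
  have k1 := key i j l m hsum h1
  have k2 := key i l j m (by rw [← hsum]; abel) h2
  have k3 := key i m j l (by rw [← hsum]; abel) h3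
  have hself : ∀ p : ℤ × ℤ, p ≠ 0 → p ≠ -p := fun p hp e => hp (self_eq_neg.mp e)
  let x : Fin 4 → ℤ × ℤ := ![i, j, l, m]
  have hx : ∀ a b, x a ≠ -x b := by
    intro a b
    fin_cases a <;> fin_cases b <;> simp [x, *]
  obtain ⟨k, hk0, hk, hsumk⟩ := exists_sum_Dbar_ne_zero hr.ne' (Finset.univ.image x) (by simp)
    (by simpa using hx) (fun q => (Finset.card {a | x a = q} : ℝ)) (by simp)
  have hx' : ∀ a, k ≠ x a ∧ k ≠ -x a := fun a => hk _ (by simp)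
  refine ⟨k, hk0, (hx' 0).1, (hx' 0).2, (hx' 1).1, (hx' 1).2, (hx' 2).1, (hx' 2).2,
    (hx' 3).1, (hx' 3).2, fun e => hsumk ?_⟩
  simp only [← nsmul_eq_mul]
  rw [← Finset.sum_comp (fun q => Dbar r q k) x, Fin.sum_univ_four]
  exact e
end

section
/- Let r > 0 be real and let i, k ∈ ℤ²₀ with i + k ≠ 0 and i − k ≠ 0. Then c_{i,k} c_{i+k,k} − c_{i,k} c_{i−k,k} = ⟨i⊥,k⟩²_r (1/|k|²_r − 1/|i|²_r)(1/|i−k|²_r − 1/|i+k|²_r). -/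
/-- The coefficient `c_{j,k} = ⟨j⊥,k⟩_r (1/|k|²_r − 1/|j|²_r)`. -/
noncomputable def cc (r : ℝ) (j k : ℤ × ℤ) : ℝ :=
  perp r j k * (1 / nsq r k - 1 / nsq r j)

theorem perp_add_self (r : ℝ) (p k : ℤ × ℤ) : perp r (p + k) k = perp r p k := by
  simp only [perp, Prod.fst_add, Prod.snd_add, Int.cast_add]
  ring

theorem perp_sub_self (r : ℝ) (p k : ℤ × ℤ) : perp r (p - k) k = perp r p k := by
  simp only [perp, Prod.fst_sub, Prod.snd_sub, Int.cast_sub]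
  ring

/-- The identity
`c_{i,k} c_{i+k,k} − c_{i,k} c_{i−k,k} = ⟨i⊥,k⟩²_r (1/|k|²_r − 1/|i|²_r)(1/|i−k|²_r − 1/|i+k|²_r)`. -/
theorem stmt19 (r : ℝ) (hr : 0 < r) (i k : ℤ × ℤ) (hi : i ≠ 0) (hk : k ≠ 0)
    (h1 : i + k ≠ 0) (h2 : i - k ≠ 0) :
    cc r i k * cc r (i + k) k - cc r i k * cc r (i - k) k = Dbar r i k := by
  unfold cc Dbar
  rw [perp_add_self, perp_sub_self]
  ring
end
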